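/- arXiv:1206.6811 — 2 statements merged into one kernel-verified Lean document; each statement's English description precedes it below -/
import Mathlib

section
/- Let λ > 0 and let M be an integer with M ≥ λ + 2. Then the tail entropy of the Poisson distribution satisfies Σ_{k=M}^∞ ( −Po(λ)(k)·log Po(λ)(k) ) ≤ μ(λ,M). -/
/-- The Poisson probability mass function with mean `lam`. -/
noncomputable def poissonPmf (lam : ℝ) (k : ℕ) : ℝ :=
  Real.exp (-lam) * lam ^ k / (Nat.factorial k)

/-- The quantity `μ(λ, M)`. -/
noncomputable def muBound (lam M : ℝ) : ℝ :=
  (max (lam * Real.log (Real.exp 1 / lam)) 0 + lam ^ 2 +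
      (6 * Real.log (2 * Real.pi) + 1) / 12) *
    Real.exp (-(lam + (M - 2) * Real.log ((M - 2) / (lam * Real.exp 1))))

theorem poissonPmf_pos {lam : ℝ} (hlam : 0 < lam) (k : ℕ) : 0 < poissonPmf lam k := by
  unfold poissonPmf
  positivity

theorem succ_mul_poissonPmf_succ (lam : ℝ) (k : ℕ) :
    ((k : ℝ) + 1) * poissonPmf lam (k + 1) = lam * poissonPmf lam k := by
  unfold poissonPmf
  have h : (Nat.factorial k : ℝ) ≠ 0 := by positivity
  have h' : (k : ℝ) + 1 ≠ 0 := by positivity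
  rw [Nat.factorial_succ]
  push_cast
  field_simp
  ring

/-- Past its mean, the Poisson mass function is decreasing. -/
theorem poissonPmf_succ_le {lam : ℝ} (hlam : 0 < lam) {k : ℕ} (hk : lam ≤ k) :
    poissonPmf lam (k + 1) ≤ poissonPmf lam k := by
  have h := succ_mul_poissonPmf_succ lam k
  have hp := poissonPmf_pos hlam k
  have hk' : (0 : ℝ) < (k : ℝ) + 1 := by positivity
  refine le_of_mul_le_mul_left ?_ hk'
  rw [h]
  exact mul_le_mul_of_nonneg_right (by linarith) hp.le

theorem log_factorial_le (k : ℕ) : Real.log (Nat.factorial k) ≤ (k : ℝ) * (k - 1) := by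
  induction k with
  | zero => simp
  | succ k ih =>
    have hk : (0 : ℝ) < (k : ℝ) + 1 := by positivity
    rw [Nat.factorial_succ, Nat.cast_mul, Real.log_mul (by positivity) (by positivity)]
    push_cast
    have := Real.log_le_sub_one_of_pos hk
    have hk0 : (0 : ℝ) ≤ k := k.cast_nonneg
    nlinarith

theorem neg_log_poissonPmf {lam : ℝ} (hlam : 0 < lam) (k : ℕ) :
    -Real.log (poissonPmf lam k) = lam - k * Real.log lam + Real.log (Nat.factorial k) := by
  unfold poissonPmf
  rw [Real.log_div (by positivity) (by positivity), Real.log_mul (by positivity) (by positivity),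
    Real.log_exp, Real.log_pow]
  ring

/-- Past the mean, the entropy term at `k + 2` is controlled by the mass at `k`. -/
theorem poisson_entropy_term_le {lam : ℝ} (hlam : 0 < lam) {k : ℕ} (hk : lam ≤ k) :
    -(poissonPmf lam (k + 2) * Real.log (poissonPmf lam (k + 2))) ≤
      (max (lam * Real.log (Real.exp 1 / lam)) 0 + lam ^ 2) * poissonPmf lam k := by
  have p0 := poissonPmf_pos hlam k
  have p1 := poissonPmf_pos hlam (k + 1)
  have p2 := poissonPmf_pos hlam (k + 2)
  have e1 := succ_mul_poissonPmf_succ lam k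
  have e2 := succ_mul_poissonPmf_succ lam (k + 1)
  have l1 := poissonPmf_succ_le hlam hk
  have l2 := poissonPmf_succ_le hlam (k := k + 1) (by push_cast; linarith)
  have hf := log_factorial_le (k + 2)
  have hlog : Real.log (Real.exp 1 / lam) = 1 - Real.log lam := by
    rw [Real.log_div (by positivity) hlam.ne', Real.log_exp]
  rw [show k + 1 + 1 = k + 2 from rfl] at e2 l2
  rw [← mul_neg, neg_log_poissonPmf hlam, hlog]
  set P0 := poissonPmf lam k
  set P1 := poissonPmf lam (k + 1)
  set P2 := poissonPmf lam (k + 2)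
  push_cast at hf e2 ⊢
  calc P2 * (lam - (k + 2) * Real.log lam + Real.log (Nat.factorial (k + 2)))
      ≤ P2 * (lam - (k + 2) * Real.log lam + ((k : ℝ) + 2) * (k + 2 - 1)) := by gcongr
    _ = lam * P2 - lam * Real.log lam * P1 + lam ^ 2 * P0 := by
        linear_combination (((k : ℝ) + 1) - Real.log lam) * e2 + lam * e1
    _ ≤ lam * P1 - lam * Real.log lam * P1 + lam ^ 2 * P0 := by gcongr
    _ = (lam * (1 - Real.log lam)) * P1 + lam ^ 2 * P0 := by ring
    _ ≤ max (lam * (1 - Real.log lam)) 0 * P1 + lam ^ 2 * P0 := by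
        gcongr
        exact le_max_left _ _
    _ ≤ max (lam * (1 - Real.log lam)) 0 * P0 + lam ^ 2 * P0 := by
        gcongr
    _ = _ := by ring

/-- Exponential tilting of the Poisson mass function from mean `lam` to a larger mean `N`. -/
theorem poissonPmf_le_tilted {lam : ℝ} (hlam : 0 < lam) {N k : ℕ} (hN : lam ≤ N) (hk : N ≤ k) :
    poissonPmf lam k ≤
      Real.exp (-lam) * (lam / N) ^ N * ((N : ℝ) ^ k / (Nat.factorial k)) := by
  have hN0 : (0 : ℝ) < N := hlam.trans_le hN
  obtain ⟨j, rfl⟩ := Nat.exists_eq_add_of_le hk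
  have h : lam ^ (N + j) ≤ (lam / N) ^ N * (N : ℝ) ^ (N + j) := by
    rw [pow_add, pow_add, ← mul_assoc, ← mul_pow, div_mul_cancel₀ _ hN0.ne']
    gcongr
  unfold poissonPmf
  rw [← mul_div_assoc, mul_assoc (Real.exp _)]
  gcongr

theorem exp_neg_add_mul_log_div {lam : ℝ} (hlam : 0 < lam) {N : ℕ} (hN : 0 < N) :
    Real.exp (-(lam + (N : ℝ) * Real.log ((N : ℝ) / (lam * Real.exp 1)))) =
      Real.exp (-lam) * (lam / N) ^ N * Real.exp N := by
  have hN0 : (0 : ℝ) < N := by exact_mod_cast hN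
  rw [← Real.exp_log (show 0 < (lam / N) ^ N by positivity), ← Real.exp_add, ← Real.exp_add,
    Real.log_pow, Real.log_div hlam.ne' hN0.ne', Real.log_div hN0.ne' (by positivity),
    Real.log_mul hlam.ne' (by positivity), Real.log_exp]
  congr 1
  ring

/-- The tail entropy of the Poisson distribution satisfies
`∑_{k=M}^∞ (-Po(λ)(k) log Po(λ)(k)) ≤ μ(λ, M)` whenever `M ≥ λ + 2`. -/
theorem poisson_tail_entropy_le_muBound
    (lam : ℝ) (hlam : 0 < lam) (M : ℕ) (hM : lam + 2 ≤ (M : ℝ)) :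
    ∑' k : ℕ, (if M ≤ k then -(poissonPmf lam k * Real.log (poissonPmf lam k)) else 0) ≤
      muBound lam (M : ℝ) := by
  have hM2 : 2 < M := by
    have : (2 : ℝ) < M := by linarith
    exact_mod_cast this
  obtain ⟨N, rfl⟩ : ∃ N, M = N + 2 := ⟨M - 2, by omega⟩
  have hN : lam ≤ N := by push_cast at hM; linarith
  have hpi : 0 ≤ Real.log (2 * Real.pi) :=
    Real.log_nonneg (by linarith [Real.pi_gt_three])
  unfold muBound
  rw [show ((N + 2 : ℕ) : ℝ) - 2 = N by push_cast; ring,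
    exp_neg_add_mul_log_div hlam (by omega)]
  set A := max (lam * Real.log (Real.exp 1 / lam)) 0 + lam ^ 2
  have hA : 0 ≤ A := add_nonneg (le_max_right _ _) (sq_nonneg _)
  set B := Real.exp (-lam) * (lam / N) ^ N
  have hB : 0 ≤ B := by positivity
  have hsum : HasSum (fun j : ℕ => A * B * ((N : ℝ) ^ j / (Nat.factorial j)))
      (A * B * Real.exp N) := by
    rw [Real.exp_eq_exp_ℝ]
    exact (NormedSpace.expSeries_div_hasSum_exp (N : ℝ)).mul_left _
  have hC : A * B * Real.exp N ≤
      (A + (6 * Real.log (2 * Real.pi) + 1) / 12) * (B * Real.exp N) := by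
    rw [mul_assoc]
    gcongr
    linarith
  refine le_trans ?_ hC
  by_cases hs : Summable fun k : ℕ =>
      if N + 2 ≤ k then -(poissonPmf lam k * Real.log (poissonPmf lam k)) else 0
  · rw [← hs.sum_add_tsum_nat_add 2, Finset.sum_eq_zero, zero_add]
    · refine hasSum_le (fun j => ?_) ((summable_nat_add_iff 2).2 hs).hasSum hsum
      split_ifs with h
      · have hj : N ≤ j := by omega
        have hj' : lam ≤ j := hN.trans (by exact_mod_cast hj)
        refine (poisson_entropy_term_le hlam hj').trans ?_
        rw [mul_assoc]
        exact mul_le_mul_of_nonneg_left (poissonPmf_le_tilted hlam hN hj) hA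
      · positivity
    · intro k hk
      rw [Finset.mem_range] at hk
      exact if_neg (by omega)
  · rw [tsum_eq_zero_of_not_summable hs]
    positivity
end

section
/- Let 0 < λ ≤ log 2 and let Q = Po(λ). Then sup_{A ⊆ ℕ₀} min{ Q(A), 1 − Q(A) } = 1 − e^{−λ}, where Q(A) = Σ_{k∈A} Q(k) and the supremum is over all subsets A of the nonnegative integers. -/
theorem hasSum_poissonPmf {lam : ℝ} (hlam : 0 ≤ lam) : HasSum (poissonPmf lam) 1 :=
  ProbabilityTheory.hasSum_one_poissonMeasure ⟨lam, hlam⟩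

theorem poissonPmf_nonneg {lam : ℝ} (hlam : 0 ≤ lam) (k : ℕ) : 0 ≤ poissonPmf lam k := by
  unfold poissonPmf
  positivity

theorem poissonPmf_zero (lam : ℝ) : poissonPmf lam 0 = Real.exp (-lam) := by
  simp [poissonPmf]

/-- A set containing `0` has mass at least `e^{-λ}`. -/
theorem exp_neg_le_tsum_poissonPmf {lam : ℝ} (hlam : 0 ≤ lam) {A : Set ℕ} (hA : 0 ∈ A) :
    Real.exp (-lam) ≤ ∑' k : A, poissonPmf lam (k : ℕ) := by
  rw [← poissonPmf_zero lam]
  exact ((hasSum_poissonPmf hlam).summable.subtype A).le_tsum (⟨0, hA⟩ : A)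
    fun k _ => poissonPmf_nonneg hlam k.1

theorem tsum_poissonPmf_add_tsum_compl {lam : ℝ} (hlam : 0 ≤ lam) (A : Set ℕ) :
    (∑' k : A, poissonPmf lam (k : ℕ)) + ∑' k : ↑Aᶜ, poissonPmf lam (k : ℕ) = 1 := by
  have hs := (hasSum_poissonPmf hlam).summable
  rw [(hs.subtype A).tsum_add_tsum_compl (hs.subtype Aᶜ), (hasSum_poissonPmf hlam).tsum_eq]

theorem min_tsum_poissonPmf_le {lam : ℝ} (hlam : 0 ≤ lam) (A : Set ℕ) :
    min (∑' k : A, poissonPmf lam (k : ℕ)) (1 - ∑' k : A, poissonPmf lam (k : ℕ)) ≤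
      1 - Real.exp (-lam) := by
  by_cases hA : 0 ∈ A
  · exact (min_le_right _ _).trans (sub_le_sub_left (exp_neg_le_tsum_poissonPmf hlam hA) 1)
  · have hc := exp_neg_le_tsum_poissonPmf hlam (A := Aᶜ) hA
    have hsum := tsum_poissonPmf_add_tsum_compl hlam A
    exact (min_le_left _ _).trans (by linarith)

/-- For `0 < λ ≤ log 2` and `Q = Po(λ)`,
`sup_{A ⊆ ℕ₀} min{Q(A), 1 - Q(A)} = 1 - e^{-λ}`. -/
theorem poisson_balanced_mass_sup
    (lam : ℝ) (hlam0 : 0 < lam) (hlam : lam ≤ Real.log 2) :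
    (⨆ A : Set ℕ, min (∑' k : A, poissonPmf lam (k : ℕ))
        (1 - ∑' k : A, poissonPmf lam (k : ℕ))) = 1 - Real.exp (-lam) := by
  refine le_antisymm (ciSup_le (min_tsum_poissonPmf_le hlam0.le)) ?_
  have hexp : 1 / 2 ≤ Real.exp (-lam) := by
    calc (1 / 2 : ℝ) = Real.exp (-Real.log 2) := by
          rw [Real.exp_neg, Real.exp_log two_pos, one_div]
      _ ≤ Real.exp (-lam) := Real.exp_le_exp.mpr (neg_le_neg hlam)
  refine le_ciSup_of_le ⟨_, Set.forall_mem_range.mpr (min_tsum_poissonPmf_le hlam0.le)⟩ {0} ?_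
  rw [tsum_singleton 0 (poissonPmf lam), poissonPmf_zero]
  exact le_min (by linarith) le_rfl
end
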